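/- (Theorem 2, multi-output immersion) Let A ∈ ℝ^{n×n}, B ∈ ℝ^{n×p}, let C_1, …, C_q be symmetric real n×n matrices and d_1, …, d_q ∈ ℝⁿ; let u : ℝ → ℝ^p be a function and x : ℝ → ℝ^n be differentiable with ẋ(t) = A x(t) + B u(t) for all t ∈ ℝ; set y_h(t) := ½ x(t)ᵀ C_h x(t) + d_hᵀ x(t) and y(t) := (y_1(t), …, y_q(t)). Set N := n(n+1)/2, x^{[2]}(t) := D_nᵀ (x(t) ⊗ x(t)), Ā := D_nᵀ (A ⊕ A) (D_n⁺)ᵀ, Ū(t) := D_nᵀ ((B u(t)) ⊗ I_n + I_n ⊗ (B u(t))); let C̄ ∈ ℝ^{q×N} be the matrix whose h-th row is ½ vech(C_h)ᵀ and D ∈ ℝ^{q×n} the matrix whose h-th row is d_hᵀ. Suppose there are m ≥ 1, sizes p_0, …, p_{m-1} ≥ 1 with p_m := 0, full-row-rank matrices L̄_k ∈ ℝ^{p_k × N}, permutation matrices P_k ∈ ℝ^{p_k × p_k} (k = 0, …, m−1), matrices M_i^{(k)} ∈ ℝ^{(p_k − p_{k+1}) × p_i} for 0 ≤ i ≤ k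 ≤ m−1 (with p_{k+1} ≤ p_k), and F ∈ ℝ^{q×p_0}, such that C̄ = F L̄_0 and, for each k = 0, …, m−1, P_k L̄_k Ā = [L̄_{k+1}; Σ_{i=0}^{k} M_i^{(k)} P_i L̄_i] (vertical stacking of a p_{k+1}×N block over a (p_k − p_{k+1})×N block; for k = m−1 the top block is empty and the identity reads P_{m-1} L̄_{m-1} Ā = Σ_{i=0}^{m-1} M_i^{(m-1)} P_i L̄_i). Define ξ_k(t) := L̄_k x^{[2]}(t) and z(t) := (P_{m-1} ξ_{m-1}(t), P_{m-2} ξ_{m-2}(t), …, P_0 ξ_0(t), x(t)) ∈ ℝ^{n + Σ_{k=0}^{m-1} p_k}. Define, for i ≤ k ≤ m−1, M̄_i^{(k)} := [0_{p_{k+1}×p_i}; M_i^{(k)}] and, for 1 ≤ k ≤ m−1, P̄_k := [P_kᵀ; 0_{(p_{k-1}−p_k)×p_k}], and for v ∈ ℝ^p let 𝒜(v) be the block matrix whose block row for index k (ordered k = m−1, m−2, …, 0 from top) has block M̄_i^{(k)} in the column of P_i ξ_i for i ≤ k, block P̄_{k+1} in the column of P_{k+1} ξ_{k+1} (for k ≤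 m−2), zeros in the remaining ξ-columns, and rightmost block P_k L̄_k D_nᵀ ((Bv) ⊗ I_n + I_n ⊗ (Bv)); the bottom block row is (0, …, 0, A). Set ℬ := [0; B] and 𝒞 := (0, …, 0, F P_0ᵀ, D). Then z is differentiable with ż(t) = 𝒜(u(t)) z(t) + ℬ u(t) and y(t) = 𝒞 z(t) for all t ∈ ℝ. -/

import Mathlib

open Matrix
open scoped Kronecker

namespace Quad

/-- Index set for the lower-triangular entries (pairs `(i,j)` with `j ≤ i`). -/
abbrev SymIdx (n : ℕ) := {p : Fin n × Fin n // p.2 ≤ p.1}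

/-- Vectorization of a matrix (stacking columns): `vec M (j, i) = M i j`. -/
def vec {n m : ℕ} (M : Matrix (Fin n) (Fin m) ℝ) : Fin m × Fin n → ℝ :=
  fun p => M p.2 p.1

/-- Half-vectorization of a (symmetric) matrix. -/
def vech {n : ℕ} (M : Matrix (Fin n) (Fin n) ℝ) : SymIdx n → ℝ :=
  fun p => M p.1.1 p.1.2

/-- The duplication matrix `D_n`. -/
def dup (n : ℕ) : Matrix (Fin n × Fin n) (SymIdx n) ℝ :=
  Matrix.of fun r c => if r = c.1 ∨ r = (c.1.2, c.1.1) then 1 else 0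

/-- The Moore–Penrose inverse `D_n⁺ = (D_nᵀ D_n)⁻¹ D_nᵀ`. -/
noncomputable def dupPinv (n : ℕ) : Matrix (SymIdx n) (Fin n × Fin n) ℝ :=
  ((dup n)ᵀ * dup n)⁻¹ * (dup n)ᵀ

/-- Kronecker sum `A ⊕ B = A ⊗ I + I ⊗ B`. -/
def kronSum {n m : ℕ} (A : Matrix (Fin n) (Fin n) ℝ) (B : Matrix (Fin m) (Fin m) ℝ) :
    Matrix (Fin n × Fin m) (Fin n × Fin m) ℝ :=
  A ⊗ₖ (1 : Matrix (Fin m) (Fin m) ℝ) + (1 : Matrix (Fin n) (Fin n) ℝ) ⊗ₖ B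

/-- Kronecker product of two (column) vectors. -/
def kronVec {a b : ℕ} (u : Fin a → ℝ) (v : Fin b → ℝ) : Fin a × Fin b → ℝ :=
  fun p => u p.1 * v p.2

/-- The Lyapunov operator `L_A(X) = X A + Aᵀ X`. -/
def lyap {n : ℕ} (A X : Matrix (Fin n) (Fin n) ℝ) : Matrix (Fin n) (Fin n) ℝ :=
  X * A + Aᵀ * X

/-- `w ⊗ I_n` for a column vector `w ∈ ℝⁿ`, an `n² × n` matrix. -/
def vecKronId {n : ℕ} (w : Fin n → ℝ) : Matrix (Fin n × Fin n) (Fin n) ℝ :=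
  Matrix.of fun pr j => w pr.1 * (if pr.2 = j then 1 else 0)

/-- `I_n ⊗ w` for a column vector `w ∈ ℝⁿ`, an `n² × n` matrix. -/
def idKronVec {n : ℕ} (w : Fin n → ℝ) : Matrix (Fin n × Fin n) (Fin n) ℝ :=
  Matrix.of fun pr j => (if pr.1 = j then 1 else 0) * w pr.2

/-- `Ā := D_nᵀ (A ⊕ A) (D_n⁺)ᵀ`. -/
noncomputable def kronAbar {n : ℕ} (A : Matrix (Fin n) (Fin n) ℝ) :
    Matrix (SymIdx n) (SymIdx n) ℝ :=
  (dup n)ᵀ * kronSum A A * (dupPinv n)ᵀ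

/-- `P` is a permutation matrix. -/
def IsPermMatrix {s : ℕ} (P : Matrix (Fin s) (Fin s) ℝ) : Prop :=
  ∃ σ : Equiv.Perm (Fin s), ∀ i j, P i j = if i = σ j then 1 else 0

/-- Identification of `Fin b ⊕ Fin (a - b)` with `Fin a` used for vertical stacking. -/
def stackEquiv {a b : ℕ} (h : b ≤ a) : Fin b ⊕ Fin (a - b) ≃ Fin a :=
  finSumFinEquiv.trans (finCongr (Nat.add_sub_cancel' h))


/-- Index type for the extended state of the multi-output immersion:
one block of size `psz k` for each `k < m`, followed by the original state. -/
abbrev ZIdx (m : ℕ) (psz : ℕ → ℕ) (n : ℕ) :=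
  ((k : Fin m) × Fin (psz (k : ℕ))) ⊕ Fin n

/-- The lower-triangular index representing the unordered pair `{r.1, r.2}`. -/
def sortIdx {n : ℕ} (r : Fin n × Fin n) : SymIdx n :=
  ⟨(max r.1 r.2, min r.1 r.2), min_le_max⟩

lemma sortIdx_val {n : ℕ} (c : SymIdx n) : sortIdx c.1 = c :=
  Subtype.ext (Prod.ext (max_eq_left c.2) (min_eq_right c.2))

lemma dup_apply {n : ℕ} (r : Fin n × Fin n) (c : SymIdx n) :
    dup n r c = if sortIdx r = c then 1 else 0 := by
  have key : (r = c.1 ∨ r = (c.1.2, c.1.1)) ↔ sortIdx r = c := by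
    constructor
    · rintro (h | h)
      · rw [h, sortIdx_val]
      · rw [h]
        exact Subtype.ext (Prod.ext (max_eq_right c.2) (min_eq_left c.2))
    · rintro rfl
      obtain ⟨i, j⟩ := r
      rcases le_total i j with h | h <;> simp [sortIdx, h]
  simp only [dup, Matrix.of_apply, key]

lemma dup_mulVec {n : ℕ} (w : SymIdx n → ℝ) :
    dup n *ᵥ w = fun r => w (sortIdx r) := by
  ext r
  simp [Matrix.mulVec, dotProduct, dup_apply]

lemma dup_mulVec_vech {n : ℕ} {X : Matrix (Fin n) (Fin n) ℝ} (hX : X.IsSymm) :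
    dup n *ᵥ vech X = vec X := by
  rw [dup_mulVec]
  ext ⟨i, j⟩
  rcases le_total i j with h | h <;> simp [sortIdx, vech, vec, h, hX.apply]

lemma isUnit_dup_transpose_mul_dup (n : ℕ) : IsUnit ((dup n)ᵀ * dup n) := by
  have hinj : Function.Injective (dup n).mulVec := by
    intro v w h
    rw [dup_mulVec, dup_mulVec] at h
    ext c
    simpa [sortIdx_val] using congrFun h c.1
  simpa using (Matrix.PosDef.conjTranspose_mul_self (dup n) hinj).isUnit

lemma kronVec_self_eq {n : ℕ} (v : Fin n → ℝ) :
    kronVec v v = dup n *ᵥ vech (Matrix.vecMulVec v v) := by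
  rw [dup_mulVec_vech]
  · ext ⟨i, j⟩
    simp [kronVec, vec, Matrix.vecMulVec_apply, mul_comm]
  · ext i j
    simp [Matrix.vecMulVec_apply, mul_comm]

lemma dupPinv_transpose_mulVec_kronVec_self {n : ℕ} (v : Fin n → ℝ) :
    (dupPinv n)ᵀ *ᵥ ((dup n)ᵀ *ᵥ kronVec v v) = kronVec v v := by
  have hdet := (Matrix.isUnit_iff_isUnit_det _).mp (isUnit_dup_transpose_mul_dup n)
  rw [kronVec_self_eq, dupPinv, Matrix.transpose_mul, Matrix.transpose_nonsing_inv,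
    Matrix.transpose_mul, Matrix.transpose_transpose, Matrix.mulVec_mulVec, Matrix.mulVec_mulVec,
    Matrix.mul_assoc, Matrix.mul_assoc, Matrix.nonsing_inv_mul _ hdet, Matrix.mul_one]

lemma kronSum_mulVec_kronVec {n : ℕ} (A : Matrix (Fin n) (Fin n) ℝ) (v : Fin n → ℝ) :
    kronSum A A *ᵥ kronVec v v = kronVec (A *ᵥ v) v + kronVec v (A *ᵥ v) := by
  ext ⟨i, j⟩
  simp only [kronSum, kronVec, Matrix.mulVec, dotProduct, Fintype.sum_prod_type, Pi.add_apply,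
    Matrix.add_apply, Matrix.kroneckerMap_apply, Matrix.one_apply, add_mul, Finset.sum_add_distrib]
  simp [Finset.sum_mul, Finset.mul_sum, mul_assoc, mul_left_comm]

lemma vecKronId_mulVec {n : ℕ} (w v : Fin n → ℝ) : vecKronId w *ᵥ v = kronVec w v := by
  ext ⟨i, j⟩
  simp [vecKronId, kronVec, Matrix.mulVec, dotProduct]

lemma idKronVec_mulVec {n : ℕ} (w v : Fin n → ℝ) : idKronVec w *ᵥ v = kronVec v w := by
  ext ⟨i, j⟩
  simp [idKronVec, kronVec, Matrix.mulVec, dotProduct, mul_comm]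

/-- Along `ẋ = A x + w`, the quadratic lift `D_nᵀ (x ⊗ x)` satisfies a bilinear equation. -/
lemma hasDerivAt_dup_transpose_mulVec_kronVec {n : ℕ} {A : Matrix (Fin n) (Fin n) ℝ}
    {w : Fin n → ℝ} {x : ℝ → Fin n → ℝ} {t : ℝ} (hx : HasDerivAt x (A *ᵥ x t + w) t) :
    HasDerivAt (fun s => (dup n)ᵀ *ᵥ kronVec (x s) (x s))
      (kronAbar A *ᵥ ((dup n)ᵀ *ᵥ kronVec (x t) (x t)) +
        ((dup n)ᵀ * (vecKronId w + idKronVec w)) *ᵥ x t) t := by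
  have hk : HasDerivAt (fun s => kronVec (x s) (x s))
      (kronVec (A *ᵥ x t + w) (x t) + kronVec (x t) (A *ᵥ x t + w)) t := by
    rw [hasDerivAt_pi] at hx ⊢
    exact fun r => (hx r.1).mul (hx r.2)
  have hD := (Matrix.mulVecLin (dup n)ᵀ).toContinuousLinearMap.hasFDerivAt.comp_hasDerivAt t hk
  refine hD.congr_deriv ?_
  change (dup n)ᵀ *ᵥ _ = _
  rw [kronAbar, ← Matrix.mulVec_mulVec, ← Matrix.mulVec_mulVec,
    dupPinv_transpose_mulVec_kronVec_self, kronSum_mulVec_kronVec, ← Matrix.mulVec_mulVec,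
    Matrix.add_mulVec, vecKronId_mulVec, idKronVec_mulVec, ← Matrix.mulVec_add]
  congr 1
  ext r
  simp only [kronVec, Pi.add_apply]
  ring

lemma half_vech_dotProduct {n : ℕ} {X : Matrix (Fin n) (Fin n) ℝ} (hX : X.IsSymm)
    (v : Fin n → ℝ) :
    (fun c => (1 / 2 : ℝ) * vech X c) ⬝ᵥ ((dup n)ᵀ *ᵥ kronVec v v) =
      (1 / 2 : ℝ) * (v ⬝ᵥ X *ᵥ v) := by
  have h : (fun c => (1 / 2 : ℝ) * vech X c) = (1 / 2 : ℝ) • vech X := rfl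
  rw [h, smul_dotProduct, smul_eq_mul, Matrix.mulVec_transpose, dotProduct_comm,
    ← Matrix.dotProduct_mulVec, dup_mulVec_vech hX]
  congr 1
  simp only [dotProduct, Fintype.sum_prod_type, kronVec, vec, Matrix.mulVec, Finset.mul_sum]
  rw [Finset.sum_comm]
  exact Finset.sum_congr rfl fun i _ => Finset.sum_congr rfl fun j _ => by ring

lemma IsPermMatrix.transpose_mul_self {s : ℕ} {P : Matrix (Fin s) (Fin s) ℝ}
    (hP : IsPermMatrix P) : Pᵀ * P = 1 := by
  obtain ⟨σ, hσ⟩ := hP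
  ext i j
  simp [Matrix.mul_apply, hσ, Matrix.one_apply, eq_comm]

lemma fromRows_submatrix_mulVec {a b c : ℕ} {κ : Type*} [Fintype κ] (e : Fin a ⊕ Fin b ≃ Fin c)
    (X : Matrix (Fin a) κ ℝ) (Y : Matrix (Fin b) κ ℝ) (v : κ → ℝ) (r : Fin c) :
    ((Matrix.fromRows X Y).submatrix e.symm id *ᵥ v) r =
      Sum.elim (X *ᵥ v) (Y *ᵥ v) (e.symm r) := by
  rw [← Matrix.fromRows_mulVec]
  rfl

/-- Theorem 2, multi-output immersion. -/
theorem multi_output_immersion {n p q m : ℕ} (hm : 1 ≤ m)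
    (A : Matrix (Fin n) (Fin n) ℝ) (B : Matrix (Fin n) (Fin p) ℝ)
    (C : Fin q → Matrix (Fin n) (Fin n) ℝ) (hC : ∀ h, (C h).IsSymm)
    (d : Fin q → Fin n → ℝ)
    (u : ℝ → Fin p → ℝ) (x : ℝ → Fin n → ℝ)
    (hx : ∀ t, HasDerivAt x (A.mulVec (x t) + B.mulVec (u t)) t)
    (y : ℝ → Fin q → ℝ)
    (hy : ∀ t h, y t h = (1 / 2 : ℝ) * (x t ⬝ᵥ (C h).mulVec (x t)) + d h ⬝ᵥ x t)
    (xsq : ℝ → SymIdx n → ℝ)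
    (hxsq : ∀ t, xsq t = (dup n)ᵀ.mulVec (kronVec (x t) (x t)))
    (Ubar : (Fin p → ℝ) → Matrix (SymIdx n) (Fin n) ℝ)
    (hUbar : ∀ v, Ubar v =
      (dup n)ᵀ * (vecKronId (B.mulVec v) + idKronVec (B.mulVec v)))
    (psz : ℕ → ℕ) (hpsz : ∀ k < m, 1 ≤ psz k) (hpm : psz m = 0)
    (hdec : ∀ k < m, psz (k + 1) ≤ psz k)
    (L : (k : ℕ) → Matrix (Fin (psz k)) (SymIdx n) ℝ)
    (hL : ∀ k < m, LinearIndependent ℝ (fun i : Fin (psz k) => L k i))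
    (P : (k : ℕ) → Matrix (Fin (psz k)) (Fin (psz k)) ℝ)
    (hP : ∀ k < m, IsPermMatrix (P k))
    (M : (k i : ℕ) → Matrix (Fin (psz k - psz (k + 1))) (Fin (psz i)) ℝ)
    (F : Matrix (Fin q) (Fin (psz 0)) ℝ)
    (hF : (Matrix.of fun (h : Fin q) (c : SymIdx n) => (1 / 2 : ℝ) * vech (C h) c)
      = F * L 0)
    (hrec : ∀ k, ∀ hk : k < m, P k * L k * kronAbar A =
      (Matrix.fromRows (L (k + 1))
        (∑ i ∈ Finset.range (k + 1), M k i * (P i * L i))).submatrix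
        (stackEquiv (hdec k hk)).symm id)
    (ξ : (k : ℕ) → ℝ → Fin (psz k) → ℝ)
    (hξ : ∀ k t, ξ k t = (L k).mulVec (xsq t))
    (z : ℝ → ZIdx m psz n → ℝ)
    (hz : ∀ t, z t = Sum.elim
      (fun s : (k : Fin m) × Fin (psz (k : ℕ)) =>
        (P (s.1 : ℕ)).mulVec (ξ (s.1 : ℕ) t) s.2)
      (x t))
    (𝒜 : (Fin p → ℝ) → Matrix (ZIdx m psz n) (ZIdx m psz n) ℝ)
    (h𝒜 : ∀ (v : Fin p → ℝ) (r c : ZIdx m psz n), 𝒜 v r c =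
      Sum.elim
        (fun s : (k : Fin m) × Fin (psz (k : ℕ)) =>
          Sum.elim
            (fun s' : (k : Fin m) × Fin (psz (k : ℕ)) =>
              if (s'.1 : ℕ) ≤ (s.1 : ℕ) then
                -- block `M̄_{i}^{(k)} = [0; M_i^{(k)}]` for `i ≤ k`
                ((Matrix.fromRows
                    (0 : Matrix (Fin (psz ((s.1 : ℕ) + 1))) (Fin (psz (s'.1 : ℕ))) ℝ)
                    (M (s.1 : ℕ) (s'.1 : ℕ))).submatrix
                  (stackEquiv (hdec (s.1 : ℕ) s.1.isLt)).symm id) s.2 s'.2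
              else if h2 : (s'.1 : ℕ) = (s.1 : ℕ) + 1 then
                -- block `P̄_{k+1} = [P_{k+1}ᵀ; 0]`
                ((Matrix.fromRows
                    (((P (s'.1 : ℕ))ᵀ).submatrix
                      (Fin.cast (congrArg psz h2).symm) id)
                    (0 : Matrix (Fin (psz (s.1 : ℕ) - psz ((s.1 : ℕ) + 1)))
                        (Fin (psz (s'.1 : ℕ))) ℝ)).submatrix
                  (stackEquiv (hdec (s.1 : ℕ) s.1.isLt)).symm id) s.2 s'.2
              else 0)
            (fun j : Fin n => (P (s.1 : ℕ) * L (s.1 : ℕ) * Ubar v) s.2 j)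
            c)
        (fun i : Fin n =>
          Sum.elim (fun _ : (k : Fin m) × Fin (psz (k : ℕ)) => (0 : ℝ))
            (fun j : Fin n => A i j) c)
        r)
    (ℬ : Matrix (ZIdx m psz n) (Fin p) ℝ)
    (hℬ : ∀ (r : ZIdx m psz n) (j : Fin p), ℬ r j =
      Sum.elim (fun _ : (k : Fin m) × Fin (psz (k : ℕ)) => (0 : ℝ))
        (fun i : Fin n => B i j) r)
    (𝒞 : Matrix (Fin q) (ZIdx m psz n) ℝ)
    (h𝒞 : ∀ (h : Fin q) (r : ZIdx m psz n), 𝒞 h r =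
      Sum.elim
        (fun s : (k : Fin m) × Fin (psz (k : ℕ)) =>
          if h0 : (s.1 : ℕ) = 0 then
            (F * (P 0)ᵀ) h (Fin.cast (congrArg psz h0) s.2)
          else 0)
        (fun i : Fin n => d h i) r) :
    ∀ t : ℝ, HasDerivAt z ((𝒜 (u t)).mulVec (z t) + ℬ.mulVec (u t)) t ∧
      y t = 𝒞.mulVec (z t) := by
  have hxsq' : xsq = fun t => (dup n)ᵀ *ᵥ kronVec (x t) (x t) := funext hxsq
  intro t
  have hd : HasDerivAt xsq (kronAbar A *ᵥ xsq t + Ubar (u t) *ᵥ x t) t := by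
    rw [hUbar, hxsq']
    exact hasDerivAt_dup_transpose_mulVec_kronVec (hx t)
  have hPξ : ∀ k < m, (P k)ᵀ *ᵥ (P k *ᵥ ξ k t) = L k *ᵥ xsq t := fun k hk => by
    rw [Matrix.mulVec_mulVec, (hP k hk).transpose_mul_self, Matrix.one_mulVec, hξ]
  refine ⟨hasDerivAt_pi.mpr ?_, ?_⟩
  · rintro (⟨k, r⟩ | i)
    · have hz' : (fun s => z s (Sum.inl ⟨k, r⟩)) =
          fun s => ((P (k : ℕ) * L (k : ℕ)) *ᵥ xsq s) r := by
        ext s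
        rw [hz, ← Matrix.mulVec_mulVec, ← hξ]
        rfl
      rw [hz']
      have hD := hasDerivAt_pi.mp ((Matrix.mulVecLin
        (P (k : ℕ) * L (k : ℕ))).toContinuousLinearMap.hasFDerivAt.comp_hasDerivAt t hd) r
      refine hD.congr_deriv ?_
      change ((P (k : ℕ) * L (k : ℕ)) *ᵥ (kronAbar A *ᵥ xsq t + Ubar (u t) *ᵥ x t)) r = _
      set e := stackEquiv (hdec (k : ℕ) k.isLt) with he
      let g : ℕ → ℝ := fun j =>
        if j ≤ (k : ℕ) then Sum.elim 0 (M (k : ℕ) j *ᵥ (P j *ᵥ ξ j t)) (e.symm r)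
        else if j = (k : ℕ) + 1 then Sum.elim (L ((k : ℕ) + 1) *ᵥ xsq t) 0 (e.symm r)
        else 0
      have hrow : (𝒜 (u t) *ᵥ z t) (Sum.inl ⟨k, r⟩) =
          ∑ j : Fin m, g j + ((P (k : ℕ) * L (k : ℕ) * Ubar (u t)) *ᵥ x t) r := by
        rw [Matrix.mulVec, dotProduct, Fintype.sum_sum_type, Fintype.sum_sigma]
        congr 1
        · refine Finset.sum_congr rfl fun j _ => ?_
          simp only [h𝒜, hz, Sum.elim_inl, g]
          by_cases h1 : (j : ℕ) ≤ k
          · simp only [h1, if_true]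
            refine (fromRows_submatrix_mulVec e 0 (M (k : ℕ) (j : ℕ))
              (P (j : ℕ) *ᵥ ξ (j : ℕ) t) r).trans ?_
            rw [Matrix.zero_mulVec]
          · by_cases h2 : (j : ℕ) = k + 1
            · obtain ⟨j, hj⟩ := j
              dsimp only at h1 h2
              subst h2
              simp only [h1, if_false, dif_pos, if_true]
              refine (fromRows_submatrix_mulVec e (P ((k : ℕ) + 1))ᵀ 0
                (P ((k : ℕ) + 1) *ᵥ ξ ((k : ℕ) + 1) t) r).trans ?_
              rw [hPξ _ hj, Matrix.zero_mulVec]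
            · simp [h1, h2]
        · simp only [h𝒜, hz, Sum.elim_inl, Sum.elim_inr]
          rfl
      have hgm : g m = 0 := by
        simp only [g, not_le.mpr k.isLt, if_false]
        split_ifs with h
        · rcases e.symm r with a | b
          · have : psz ((k : ℕ) + 1) = 0 := h ▸ hpm
            exact absurd a.isLt (by omega)
          · rfl
        · rfl
      have hsum : ∑ j : Fin m, g j = ((P (k : ℕ) * L (k : ℕ) * kronAbar A) *ᵥ xsq t) r := by
        rw [Fin.sum_univ_eq_sum_range g m, hrec k k.isLt, fromRows_submatrix_mulVec,
          ← add_zero (∑ j ∈ Finset.range m, g j), ← hgm, ← Finset.sum_range_succ,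
          ← Finset.sum_subset (Finset.range_subset_range.mpr
            (Nat.succ_le_succ (Nat.succ_le_of_lt k.isLt))), Finset.sum_range_succ]
        · have hlow : ∑ j ∈ Finset.range ((k : ℕ) + 1), g j = ∑ j ∈ Finset.range ((k : ℕ) + 1),
              Sum.elim 0 (M (k : ℕ) j *ᵥ (P j *ᵥ ξ j t)) (e.symm r) :=
            Finset.sum_congr rfl fun j hj =>
              if_pos (Nat.lt_succ_iff.mp (Finset.mem_range.mp hj))
          have htop : g ((k : ℕ) + 1) = Sum.elim (L ((k : ℕ) + 1) *ᵥ xsq t) 0 (e.symm r) := by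
            simp [g]
          rw [hlow, htop, ← he]
          rcases e.symm r with a | b
          · simp
          · simp [Matrix.sum_mulVec, hξ]
        · intro j _ hj
          rw [Finset.mem_range, not_lt] at hj
          simp only [g]
          rw [if_neg (by omega), if_neg (by omega)]
      have hℬ0 : (ℬ *ᵥ u t) (Sum.inl ⟨k, r⟩) = 0 := by
        simp [Matrix.mulVec, dotProduct, hℬ]
      rw [Pi.add_apply, hrow, hsum, hℬ0, add_zero, Matrix.mulVec_add, Matrix.mulVec_mulVec,
        Matrix.mulVec_mulVec, Pi.add_apply]
    · have hz' : (fun s => z s (Sum.inr i)) = fun s => x s i := by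
        ext s
        rw [hz, Sum.elim_inr]
      rw [hz']
      refine (hasDerivAt_pi.mp (hx t) i).congr_deriv ?_
      simp [Matrix.mulVec, dotProduct, h𝒜, hℬ, hz]
  · ext h
    have hquad : (F *ᵥ (L 0 *ᵥ xsq t)) h = (1 / 2 : ℝ) * (x t ⬝ᵥ C h *ᵥ x t) := by
      rw [Matrix.mulVec_mulVec, ← hF, hxsq, ← half_vech_dotProduct (hC h)]
      rfl
    rw [hy, ← hquad, ← hPξ 0 hm, Matrix.mulVec_mulVec]
    change _ = ∑ c, 𝒞 h c * z t c
    rw [Fintype.sum_sum_type, Fintype.sum_sigma, Finset.sum_eq_single (⟨0, hm⟩ : Fin m)]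
    · simp only [h𝒞, hz, Sum.elim_inl, Sum.elim_inr, dif_pos]
      rfl
    · intro j _ hj
      have hj' : (j : ℕ) ≠ 0 := fun h0 => hj (Fin.ext h0)
      simp [h𝒞, hj']
    · simp

end Quad
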